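/- Let T be a tree of diameter exactly 4 and let u be its central vertex (the unique vertex at distance at most 2 from every vertex of T). Suppose u has k neighbors of degree 1 and exactly ℓ = 2 neighbors of degree at least 2. Then γ_e(T) = 2 and the order of T is at least 5. -/

import Mathlib

open SimpleGraph

/-- The contribution `(1/2)^(d-1)` of a vertex at `S`-restricted distance `d`,
with `(1/2)^∞ = 0`. -/
noncomputable def expStep (d : ℕ∞) : ℝ :=
  if h : d = ⊤ then 0 else (1 / 2 : ℝ) ^ ((d.untop h : ℤ) - 1)

/-- `expDist G S u v` is the minimum number of edges of a walk in `G` from `u` to `v`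
such that `v` is the only vertex of the walk belonging to `S` (i.e. the distance from `u`
to `v ∈ S` in `G - (S \ {v})`), and `⊤` if no such walk exists. -/
noncomputable def expDist {V : Type*} (G : SimpleGraph V) (S : Finset V) (u v : V) : ℕ∞ :=
  sInf {n : ℕ∞ | ∃ p : G.Walk u v, (∀ x ∈ p.support, x ∈ S → x = v) ∧ (p.length : ℕ∞) = n}

/-- The weight `w_{(G,S)}(u) = Σ_{v ∈ S} (1/2)^(dist_{(G,S)}(u,v) - 1)`. -/
noncomputable def expWeight {V : Type*} (G : SimpleGraph V) (S : Finset V) (u : V) : ℝ :=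
  ∑ v ∈ S, expStep (expDist G S u v)

/-- `S` is an exponential dominating set of `G`. -/
def IsExpDomSet {V : Type*} (G : SimpleGraph V) (S : Finset V) : Prop :=
  ∀ u : V, 1 ≤ expWeight G S u

/-- The exponential domination number of `G`. -/
noncomputable def expDomNum {V : Type*} (G : SimpleGraph V) : ℕ :=
  sInf {k : ℕ | ∃ S : Finset V, IsExpDomSet G S ∧ S.card = k}

lemma expStep_coe (n : ℕ) : expStep (n : ℕ∞) = (1 / 2 : ℝ) ^ ((n : ℤ) - 1) := by
  have h : (n : ℕ∞) ≠ ⊤ := ENat.natCast_ne_top n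
  unfold expStep
  rw [dif_neg h]
  rfl

lemma expStep_nonneg (d : ℕ∞) : 0 ≤ expStep d := by
  unfold expStep
  split_ifs <;> positivity

lemma expStep_antitone : Antitone expStep := by
  intro d e hde
  induction e using ENat.recTopCoe with
  | top => simpa [expStep] using expStep_nonneg d
  | coe e =>
    lift d to ℕ using ne_top_of_le_ne_top (ENat.natCast_ne_top e) hde
    rw [expStep_coe, expStep_coe]
    refine zpow_le_zpow_right_of_le_one₀ (by norm_num) (by norm_num) ?_
    have : d ≤ e := by exact_mod_cast hde
    omega

lemma expDist_le_length {V : Type*} {G : SimpleGraph V} {S : Finset V} {u v : V}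
    (p : G.Walk u v) (hp : ∀ x ∈ p.support, x ∈ S → x = v) :
    expDist G S u v ≤ p.length :=
  sInf_le ⟨p, hp, rfl⟩

lemma edist_le_expDist {V : Type*} (G : SimpleGraph V) (S : Finset V) (u v : V) :
    G.edist u v ≤ expDist G S u v := by
  refine le_sInf ?_
  rintro _ ⟨p, -, rfl⟩
  exact G.edist_le p

lemma expStep_le_expWeight {V : Type*} (G : SimpleGraph V) {S : Finset V} (u : V) {v : V}
    (hv : v ∈ S) : expStep (expDist G S u v) ≤ expWeight G S u :=
  Finset.single_le_sum (f := fun v => expStep (expDist G S u v))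
    (fun _ _ => expStep_nonneg _) hv

lemma one_le_expWeight_of_mem {V : Type*} (G : SimpleGraph V) {S : Finset V} {u : V}
    (hu : u ∈ S) : 1 ≤ expWeight G S u := by
  refine le_trans ?_ (expStep_le_expWeight G u hu)
  refine le_trans ?_ (expStep_antitone (expDist_le_length (Walk.nil : G.Walk u u) (by simp)))
  rw [expStep_coe]
  norm_num

lemma one_le_expWeight_of_adj {V : Type*} {G : SimpleGraph V} {S : Finset V} {u v : V}
    (hv : v ∈ S) (h : G.Adj u v) : 1 ≤ expWeight G S u := by
  by_cases hu : u ∈ S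
  · exact one_le_expWeight_of_mem G hu
  refine le_trans ?_ (expStep_le_expWeight G u hv)
  refine le_trans ?_ (expStep_antitone (expDist_le_length h.toWalk ?_))
  · rw [expStep_coe]
    norm_num
  · intro x hx hxS
    simp only [Adj.toWalk, Walk.support_cons, Walk.support_nil, List.mem_cons,
      List.not_mem_nil, or_false] at hx
    rcases hx with rfl | rfl
    · exact absurd hxS hu
    · rfl

lemma half_le_expStep_of_adj_adj {V : Type*} {G : SimpleGraph V} {S : Finset V} {x u v : V}
    (hx : x ∉ S) (hu : u ∉ S) (hxu : G.Adj x u) (huv : G.Adj u v) :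
    1 / 2 ≤ expStep (expDist G S x v) := by
  refine le_trans ?_ (expStep_antitone
    (expDist_le_length (Walk.cons hxu (Walk.cons huv Walk.nil)) ?_))
  · rw [expStep_coe]
    norm_num
  · intro y hy hyS
    simp only [Walk.support_cons, Walk.support_nil, List.mem_cons,
      List.not_mem_nil, or_false] at hy
    rcases hy with rfl | rfl | rfl
    · exact absurd hyS hx
    · exact absurd hyS hu
    · rfl

lemma one_le_expWeight_pair {V : Type*} [DecidableEq V] {G : SimpleGraph V} {x u a b : V}
    (hab : a ≠ b) (hxu : G.Adj x u) (hua : G.Adj u a) (hub : G.Adj u b) :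
    1 ≤ expWeight G {a, b} x := by
  by_cases hx : x ∈ ({a, b} : Finset V)
  · exact one_le_expWeight_of_mem G hx
  have hu : u ∉ ({a, b} : Finset V) := by simp [hua.ne, hub.ne]
  have h₁ := half_le_expStep_of_adj_adj hx hu hxu hua
  have h₂ := half_le_expStep_of_adj_adj hx hu hxu hub
  rw [expWeight, Finset.sum_pair hab]
  linarith

lemma not_isExpDomSet_empty {V : Type*} [Nonempty V] (G : SimpleGraph V) :
    ¬ IsExpDomSet G ∅ := by
  intro h
  have := h (Classical.arbitrary V)
  norm_num [expWeight] at this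

lemma IsExpDomSet.edist_le_one {V : Type*} {G : SimpleGraph V} {v : V}
    (h : IsExpDomSet G {v}) (w : V) : G.edist w v ≤ 1 := by
  by_contra! hlt
  have h₁ := h w
  rw [expWeight, Finset.sum_singleton] at h₁
  have h₂ : ((2 : ℕ) : ℕ∞) ≤ expDist G {v} w v := by
    refine le_trans ?_ (edist_le_expDist G {v} w v)
    have := Order.add_one_le_of_lt hlt
    rwa [one_add_one_eq_two] at this
  have h₃ := expStep_antitone h₂
  rw [expStep_coe] at h₃
  norm_num at h₃
  linarith

lemma SimpleGraph.Connected.two_le_card_of_isExpDomSet {V : Type*} {G : SimpleGraph V}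
    (hG : G.Connected) {x y : V} (hxy : 2 < G.dist x y) {S : Finset V}
    (hS : IsExpDomSet G S) : 2 ≤ S.card := by
  have := hG.nonempty
  by_contra! hlt
  obtain h | h : S.card = 0 ∨ S.card = 1 := by omega
  · rw [Finset.card_eq_zero] at h
    exact not_isExpDomSet_empty G (h ▸ hS)
  · obtain ⟨v, rfl⟩ := Finset.card_eq_one.1 h
    have hd (w : V) : G.dist w v ≤ 1 := by
      have := hS.edist_le_one w
      rw [← (hG w v).coe_dist_eq_edist] at this
      exact_mod_cast this
    have h₁ := hd x
    have h₂ := hd y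
    rw [G.dist_comm] at h₂
    have := hG.dist_triangle (u := x) (v := v) (w := y)
    omega

lemma SimpleGraph.exists_adj_adj_of_dist_eq_two {V : Type*} {G : SimpleGraph V} {u x : V}
    (h : G.dist u x = 2) : ∃ y, G.Adj u y ∧ G.Adj y x := by
  have hr : G.Reachable u x := by
    by_contra hr
    rw [dist_eq_zero_of_not_reachable hr] at h
    omega
  obtain ⟨p, hp⟩ := hr.exists_walk_length_eq_dist
  rw [h] at hp
  cases p with
  | nil => simp at hp
  | cons h₁ p =>
    cases p with
    | nil => simp at hp
    | cons h₂ p =>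
      cases p with
      | nil => exact ⟨_, h₁, h₂⟩
      | cons => simp at hp

lemma isExpDomSet_pair {V : Type*} [Fintype V] [DecidableEq V] {G : SimpleGraph V}
    [DecidableRel G.Adj] (hG : G.Connected) {u a b : V} (hu : ∀ v, G.dist u v ≤ 2)
    (hab : a ≠ b)
    (hfilter : ((G.neighborFinset u).filter fun v => 2 ≤ G.degree v) = {a, b}) :
    IsExpDomSet G {a, b} := by
  have hadj {y : V} (hy : y ∈ ({a, b} : Finset V)) : G.Adj u y := by
    rw [← hfilter, Finset.mem_filter, mem_neighborFinset] at hy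
    exact hy.1
  have ha : a ∈ ({a, b} : Finset V) := by simp
  have hb : b ∈ ({a, b} : Finset V) := by simp
  intro x
  have hx := hu x
  obtain h | h | h : G.dist u x = 0 ∨ G.dist u x = 1 ∨ G.dist u x = 2 := by omega
  · rw [hG.dist_eq_zero_iff] at h
    subst h
    exact one_le_expWeight_of_adj ha (hadj ha)
  · rw [dist_eq_one_iff_adj] at h
    exact one_le_expWeight_pair hab h.symm (hadj ha) (hadj hb)
  · obtain ⟨y, huy, hyx⟩ := exists_adj_adj_of_dist_eq_two h
    have hux : u ≠ x := by
      rintro rfl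
      simp at h
    have hy : y ∈ ({a, b} : Finset V) := by
      rw [← hfilter, Finset.mem_filter, mem_neighborFinset]
      refine ⟨huy, ?_⟩
      rw [← card_neighborFinset_eq_degree]
      exact Finset.one_lt_card.2 ⟨u, by simpa using huy.symm, x, by simpa using hyx, hux⟩
    exact one_le_expWeight_of_adj hy hyx.symm

/-- Lemma 5(iii)(a): let `T` be a tree of diameter `4` with central vertex `u`
(the vertex at distance at most `2` from every vertex), having `k` neighbors of
degree `1` and exactly `ℓ = 2` neighbors of degree at least `2`. Then
`γ_e(T) = 2` and `n(T) ≥ 5`. -/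
theorem expDomNum_diam_four_ell_two {V : Type*} [Fintype V] [DecidableEq V]
    (T : SimpleGraph V) [DecidableRel T.Adj] (hT : T.IsTree) (hdiam : T.diam = 4)
    (u : V) (hu : ∀ v : V, T.dist u v ≤ 2) (k : ℕ)
    (hk : ((T.neighborFinset u).filter fun v => T.degree v = 1).card = k)
    (hl : ((T.neighborFinset u).filter fun v => 2 ≤ T.degree v).card = 2) :
    expDomNum T = 2 ∧ 5 ≤ Fintype.card V := by
  have hG := hT.connected
  have := hG.nonempty
  obtain ⟨x, y, hxy⟩ := T.exists_dist_eq_diam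
  rw [hdiam] at hxy
  constructor
  · obtain ⟨a, b, hab, hfilter⟩ := Finset.card_eq_two.1 hl
    have hmem : 2 ∈ {k : ℕ | ∃ S : Finset V, IsExpDomSet T S ∧ S.card = k} :=
      ⟨{a, b}, isExpDomSet_pair hG hu hab hfilter, Finset.card_pair hab⟩
    refine le_antisymm (Nat.sInf_le hmem) (le_csInf ⟨2, hmem⟩ ?_)
    rintro _ ⟨S, hS, rfl⟩
    exact hG.two_le_card_of_isExpDomSet (x := x) (y := y) (by omega) hS
  · obtain ⟨p, hp, hlen⟩ := hG.exists_path_of_dist x y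
    have := hp.length_lt
    omega
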